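/- arXiv:2510.18916 — 5 statements merged into one kernel-verified Lean document; each statement's English description precedes it below -/
import Mathlib

section
/- Let g ≥ 2 be an integer. If integers k ≥ 1, digits 1 ≤ d₁, d₂, d₃, d₄ ≤ g − 1 and exponents 1 ≤ ℓ ≤ m ≤ n ≤ t with t ≥ 2 satisfy N_k = d₁(gˡ−1)/(g−1) · d₂(gᵐ−1)/(g−1) · d₃(gⁿ−1)/(g−1) · d₄(gᵗ−1)/(g−1), then k < 12·t·log g. -/
/-- The Narayana sequence: N₀ = 0, N₁ = N₂ = 1, Nₙ = Nₙ₋₁ + Nₙ₋₃. -/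
def narayana : ℕ → ℕ
  | 0 => 0
  | 1 => 1
  | 2 => 1
  | n + 3 => narayana (n + 2) + narayana n

theorem nara_lower (k : ℕ) : (293/200 : ℝ) ^ (k+1) ≤ (293/200 : ℝ) ^ 3 * narayana (k+1) ∧
    (293/200 : ℝ) ^ (k+2) ≤ (293/200 : ℝ) ^ 3 * narayana (k+2) ∧
    (293/200 : ℝ) ^ (k+3) ≤ (293/200 : ℝ) ^ 3 * narayana (k+3) := by
  induction k with
  | zero => norm_num [narayana]
  | succ k ih =>
    obtain ⟨h1, h2, h3⟩ := ih
    refine ⟨h2, h3, ?_⟩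
    have e : narayana (k+1+3) = narayana (k+3) + narayana (k+1) := by
      rw [narayana]
    rw [e]
    push_cast
    have hp : (0:ℝ) < (293/200 : ℝ) ^ (k+1) := by positivity
    have e3 : (293/200 : ℝ) ^ (k+3) = (293/200 : ℝ) ^ (k+1) * (293/200)^2 := by ring
    have e4 : (293/200 : ℝ) ^ (k+1+3) = (293/200 : ℝ) ^ (k+1) * (293/200)^3 := by ring
    rw [e4]
    rw [e3] at h3
    nlinarith

theorem nara_mono : Monotone narayana := by
  apply monotone_nat_of_le_succ
  intro n
  match n with
  | 0 => simp [narayana]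
  | 1 => simp [narayana]
  | n + 2 => rw [show n + 2 + 1 = n + 3 from rfl, narayana]; omega

theorem log_a_lower : (19/50 : ℝ) ≤ Real.log (293/200) := by
  have h : (19:ℝ) ≤ Real.log ((293/200)^50) := by
    rw [Real.le_log_iff_exp_le (by positivity)]
    have : Real.exp 19 = (Real.exp 1)^19 := by rw [← Real.exp_nat_mul]; norm_num
    rw [this]
    have h1 : Real.exp 1 ≤ 2.7183 := by have := Real.exp_one_lt_d9; linarith
    calc (Real.exp 1)^19 ≤ (2.7183:ℝ)^19 := by gcongr
      _ ≤ _ := by norm_num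
  rw [Real.log_pow] at h
  push_cast at h
  linarith

theorem narayana_k_lt_12t_log_g (g k d₁ d₂ d₃ d₄ ℓ m n t : ℕ) (hg : 2 ≤ g) (hk : 1 ≤ k)
    (hd₁ : 1 ≤ d₁) (hd₁g : d₁ ≤ g - 1) (hd₂ : 1 ≤ d₂) (hd₂g : d₂ ≤ g - 1)
    (hd₃ : 1 ≤ d₃) (hd₃g : d₃ ≤ g - 1) (hd₄ : 1 ≤ d₄) (hd₄g : d₄ ≤ g - 1)
    (hℓ : 1 ≤ ℓ) (hℓm : ℓ ≤ m) (hmn : m ≤ n) (hnt : n ≤ t)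
    (heq : narayana k * (g - 1) ^ 4 =
      d₁ * d₂ * d₃ * d₄ * (g ^ ℓ - 1) * (g ^ m - 1) * (g ^ n - 1) * (g ^ t - 1)) (ht : 2 ≤ t) :
    (k : ℝ) < 12 * t * Real.log g := by
  have hub : narayana k ≤ (g ^ t - 1) ^ 4 := by
    have hpos : 0 < (g - 1) ^ 4 := by
      have : 0 < g - 1 := by omega
      positivity
    apply Nat.le_of_mul_le_mul_right _ hpos
    have key : ∀ x, x ≤ t → g ^ x - 1 ≤ g ^ t - 1 := fun x hx =>
      Nat.sub_le_sub_right (Nat.pow_le_pow_right (by omega) hx) 1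
    rw [heq]
    calc _ ≤ (g-1) * (g-1) * (g-1) * (g-1) * (g^t-1) * (g^t-1) * (g^t-1) * (g^t-1) := by
          gcongr ?_ * ?_ * ?_ * ?_ * ?_ * ?_ * ?_ * ?_
          · exact key _ (by omega)
          · exact key _ (by omega)
          · exact key _ (by omega)
          · exact le_rfl
      _ = _ := by ring
  have hl2 := Real.log_two_gt_d9
  by_cases hc : g = 2 ∧ t = 2
  · obtain ⟨rfl, rfl⟩ := hc
    have hk13 : k ≤ 13 := by
      by_contra hcon
      have h1 := nara_mono (show 14 ≤ k by omega)
      have h2 : narayana 14 = 88 := by simp [narayana]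
      norm_num at hub
      omega
    have : (k:ℝ) ≤ 13 := by exact_mod_cast hk13
    push_cast
    linarith
  · have hX : 3 * Real.log 2 ≤ t * Real.log g := by
      by_cases h2 : g = 2
      · subst h2
        have ht3 : (3:ℝ) ≤ t := by
          have : 3 ≤ t := by omega
          exact_mod_cast this
        push_cast
        gcongr
      · have hg3 : (3:ℝ) ≤ g := by
          have : 3 ≤ g := by omega
          exact_mod_cast this
        have ht2 : (2:ℝ) ≤ t := by exact_mod_cast ht
        have h3 : 3 * Real.log 2 ≤ 2 * Real.log 3 := by
          have : Real.log (2^3) ≤ Real.log (3^2) := Real.log_le_log (by norm_num) (by norm_num)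
          rw [Real.log_pow, Real.log_pow] at this
          exact_mod_cast this
        refine h3.trans ?_
        have : Real.log 3 ≤ Real.log g := Real.log_le_log (by norm_num) hg3
        have : 0 ≤ Real.log 3 := Real.log_nonneg (by norm_num)
        gcongr
    have hg0 : (0:ℝ) < g := by
      have : 0 < g := by omega
      exact_mod_cast this
    have hlow : (293/200 : ℝ) ^ k ≤ (293/200 : ℝ) ^ 3 * narayana k := by
      have := (nara_lower (k-1)).1
      rwa [Nat.sub_add_cancel hk] at this
    have hub2 : (narayana k : ℝ) ≤ ((g:ℝ) ^ t) ^ 4 := by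
      have : narayana k ≤ (g ^ t) ^ 4 := hub.trans (Nat.pow_le_pow_left (Nat.sub_le _ _) 4)
      exact_mod_cast this
    have hall : (293/200 : ℝ) ^ k ≤ (293/200 : ℝ) ^ 3 * ((g:ℝ) ^ t) ^ 4 :=
      hlow.trans (by gcongr)
    have hlog := Real.log_le_log (by positivity) hall
    rw [Real.log_mul (by positivity) (by positivity), Real.log_pow, Real.log_pow, Real.log_pow,
      Real.log_pow] at hlog
    push_cast at hlog
    have hL := log_a_lower
    by_contra hcon
    push Not at hcon
    have hk3 : (0:ℝ) ≤ (k:ℝ) - 3 := by nlinarith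
    nlinarith [mul_le_mul_of_nonneg_left hL hk3]
end

section
/- Let g ≥ 2 be an integer, α the unique real root greater than 1 of x³ − x² − 1, and a = α²/(α³ + 2). For all integers k ≥ 1, digits 1 ≤ d₁, d₂, d₃, d₄ ≤ g − 1 and exponents ℓ, m, n, t ≥ 1, one has a·(g−1)⁴/(d₁d₂d₃d₄) · α^k · g^{−(ℓ+m+n+t)} ≠ 1. -/
lemma aux_rat (w : ℚ) (h : w ^ 3 = w ^ 2 + 1) : False := by
  have hi : IsIntegral ℤ w := by
    refine ⟨Polynomial.X ^ 3 - Polynomial.X ^ 2 - 1, ?_, ?_⟩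
    · monicity!
    · simp [h]
  obtain ⟨z, hz⟩ := IsIntegrallyClosed.isIntegral_iff.1 hi
  have hz' : (z : ℚ) = w := by simpa using hz
  rw [← hz'] at h
  have h2 : z ^ 3 = z ^ 2 + 1 := by exact_mod_cast h
  have h3 : z ∣ 1 := ⟨z ^ 2 - z, by linear_combination -h2⟩
  rcases Int.isUnit_iff.1 (isUnit_of_dvd_one h3) with h | h <;> subst h <;> norm_num at h2

lemma aux_lin (α : ℝ) (hroot : α ^ 3 = α ^ 2 + 1) (p q : ℚ) (h : (p : ℝ) * α + q = 0) :
    p = 0 := by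
  by_contra hp
  have hp' : (p : ℝ) ≠ 0 := by exact_mod_cast hp
  have h1 : α = ((-q / p : ℚ) : ℝ) := by
    push_cast
    field_simp
    linarith
  rw [h1] at hroot
  exact aux_rat (-q / p) (by exact_mod_cast hroot)

lemma aux_quad (α : ℝ) (hroot : α ^ 3 = α ^ 2 + 1) (p q r : ℚ)
    (h : (p : ℝ) * α ^ 2 + q * α + r = 0) : p = 0 ∧ q = 0 ∧ r = 0 := by
  have hp : p = 0 := by
    by_contra hp
    have hp' : (p : ℝ) ≠ 0 := by exact_mod_cast hp
    obtain ⟨u, hu⟩ : ∃ u : ℚ, u = -q / p := ⟨_, rfl⟩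
    obtain ⟨v, hv⟩ : ∃ v : ℚ, v = -r / p := ⟨_, rfl⟩
    have h1 : α ^ 2 = u * α + v := by
      rw [hu, hv]
      push_cast
      field_simp
      linarith
    have h2 : ((u ^ 2 + v - u : ℚ) : ℝ) * α + ((u * v - v - 1 : ℚ) : ℝ) = 0 := by
      push_cast
      linear_combination hroot - (α + u - 1) * h1
    have h3 := aux_lin α hroot _ _ h2
    have h4 : u * v - v - 1 = 0 := by
      rw [h3] at h2
      simp only [Rat.cast_zero, zero_mul, zero_add] at h2
      exact_mod_cast h2
    apply aux_rat (1 - u)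
    linear_combination h4 - (u - 1) * h3
  subst hp
  simp only [Rat.cast_zero, zero_mul, zero_add] at h
  have hq := aux_lin α hroot _ _ h
  subst hq
  simp only [Rat.cast_zero, zero_mul, zero_add] at h
  exact ⟨rfl, rfl, by exact_mod_cast h⟩

lemma aux_pow (α : ℝ) (hroot : α ^ 3 = α ^ 2 + 1) (j : ℕ) :
    ∃ A B C : ℕ, α ^ (j + 3) = A * α ^ 2 + B * α + C ∧ 1 ≤ A ∧ 1 ≤ C ∧
      (1 ≤ B ∨ (A = 1 ∧ C = 1)) := by
  induction j with
  | zero => exact ⟨1, 0, 1, by simp [hroot], le_rfl, le_rfl, Or.inr ⟨rfl, rfl⟩⟩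
  | succ j ih =>
    obtain ⟨A, B, C, h, hA, hC, -⟩ := ih
    refine ⟨A + B, C, A, ?_, by omega, hA, Or.inl hC⟩
    push_cast
    linear_combination α * h + A * hroot

theorem lambda_one_ne_zero (g : ℕ) (hg : 2 ≤ g)
    (α : ℝ) (hα : 1 < α) (hroot : α ^ 3 = α ^ 2 + 1)
    (a : ℝ) (ha : a = α ^ 2 / (α ^ 3 + 2))
    (k d₁ d₂ d₃ d₄ ℓ m n t : ℕ) (hk : 1 ≤ k)
    (hd₁ : 1 ≤ d₁) (hd₁g : d₁ ≤ g - 1) (hd₂ : 1 ≤ d₂) (hd₂g : d₂ ≤ g - 1)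
    (hd₃ : 1 ≤ d₃) (hd₃g : d₃ ≤ g - 1) (hd₄ : 1 ≤ d₄) (hd₄g : d₄ ≤ g - 1)
    (hℓ : 1 ≤ ℓ) (hm : 1 ≤ m) (hn : 1 ≤ n) (ht : 1 ≤ t) :
    a * ((g : ℝ) - 1) ^ 4 / ((d₁ : ℝ) * d₂ * d₃ * d₄) * α ^ k *
      (g : ℝ) ^ (-((ℓ : ℤ) + m + n + t)) ≠ 1 := by
  intro h
  have hg1 : (0 : ℝ) < (g : ℝ) - 1 := by
    have : (2 : ℝ) ≤ g := by exact_mod_cast hg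
    linarith
  have hg0 : (0 : ℝ) < g := by linarith
  have e : (g : ℝ) ^ (-((ℓ : ℤ) + m + n + t)) = ((g : ℝ) ^ (ℓ + m + n + t))⁻¹ := by
    rw [zpow_neg, ← zpow_natCast]
    push_cast
    rfl
  have h1 : (0 : ℝ) < d₁ := by exact_mod_cast hd₁
  have h2 : (0 : ℝ) < d₂ := by exact_mod_cast hd₂
  have h3 : (0 : ℝ) < d₃ := by exact_mod_cast hd₃
  have h4 : (0 : ℝ) < d₄ := by exact_mod_cast hd₄
  obtain ⟨P, hP⟩ : ∃ P : ℚ, P = ((g : ℚ) - 1) ^ 4 := ⟨_, rfl⟩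
  obtain ⟨Q, hQ⟩ : ∃ Q : ℚ, Q = (d₁ : ℚ) * d₂ * d₃ * d₄ * (g : ℚ) ^ (ℓ + m + n + t) := ⟨_, rfl⟩
  have hPr : (P : ℝ) = ((g : ℝ) - 1) ^ 4 := by rw [hP]; push_cast; rfl
  have hQr : (Q : ℝ) = (d₁ : ℝ) * d₂ * d₃ * d₄ * (g : ℝ) ^ (ℓ + m + n + t) := by
    rw [hQ]; push_cast; rfl
  have hP0 : P ≠ 0 := by
    have : (0 : ℝ) < P := by rw [hPr]; positivity
    exact_mod_cast this.ne'
  have hQ0 : (Q : ℝ) ≠ 0 := by rw [hQr]; positivity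
  have hs : α ^ 2 + 3 ≠ 0 := by positivity
  have key : α ^ 2 * P * α ^ k = (α ^ 2 + 3) * Q := by
    have h' : α ^ 2 * P * α ^ k / ((α ^ 2 + 3) * Q) = 1 := by
      rw [← h, e, ha, hPr, hQr, hroot, show α ^ 2 + 1 + 2 = α ^ 2 + 3 by ring]
      field_simp
    exact (div_eq_one_iff_eq (mul_ne_zero hs hQ0)).1 h'
  obtain ⟨j, rfl⟩ : ∃ j, k = j + 1 := ⟨k - 1, by omega⟩
  obtain ⟨A, B, C, hABC, -, -, hB⟩ := aux_pow α hroot j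
  obtain ⟨hx, hy, hz⟩ := aux_quad α hroot (P * A - Q) (P * B) (P * C - 3 * Q) (by
    push_cast
    linear_combination key - P * hABC)
  rcases hB with hB | ⟨rfl, rfl⟩
  · rcases mul_eq_zero.1 hy with h0 | h0
    · exact hP0 h0
    · have : B = 0 := by exact_mod_cast h0
      omega
  · push_cast at hx hz
    apply hP0
    linarith
end

section
/- Let g ≥ 2 be an integer, α the unique real root greater than 1 of x³ − x² − 1, and a = α²/(α³ + 2). If integers k ≥ 1, digits 1 ≤ d₁, d₂, d₃, d₄ ≤ g − 1 and exponents 1 ≤ ℓ ≤ m ≤ n ≤ t with t ≥ 2 satisfy N_k = d₁(gˡ−1)/(g−1) · d₂(gᵐ−1)/(g−1) · d₃(gⁿ−1)/(g−1) · d₄(gᵗ−1)/(g−1), then |a·(g−1)⁴/(d₁d₂d₃d₄) · α^k · g^{−(ℓ+m+n+t)} − 1| < 16/gˡ. -/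
theorem narayana_binet_err (α : ℝ) (hα : 1 < α) (hroot : α ^ 3 = α ^ 2 + 1)
    (a : ℝ) (ha : a = α ^ 2 / (α ^ 3 + 2)) (k : ℕ) :
    |(narayana k : ℝ) - a * α ^ k| ≤ 3 := by
  have h1 : 1.4 < α := by
    by_contra h
    push Not at h
    nlinarith [mul_nonneg (sub_nonneg.2 hα.le) (sub_nonneg.2 h), sq_nonneg α]
  have h2 : α < 1.5 := by
    by_contra h
    push Not at h
    nlinarith [mul_nonneg (sq_nonneg α) (sub_nonneg.2 h)]
  have hpos : (0 : ℝ) < α ^ 3 + 2 := by positivity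
  have ha' : a * (α ^ 3 + 2) = α ^ 2 := by rw [ha]; field_simp
  have ha0 : 0 ≤ a := by rw [ha]; positivity
  have ha1 : a ≤ 1 / 2 := by
    rw [ha, div_le_iff₀ hpos]; nlinarith
  obtain ⟨e, he⟩ : ∃ e : ℕ → ℝ, ∀ k, e k = (narayana k : ℝ) - a * α ^ k := ⟨_, fun _ => rfl⟩
  have hrec3 : ∀ k, e (k + 3) = e (k + 2) + e k := by
    intro k
    rw [he, he, he, narayana]
    push_cast
    have : α ^ (k + 3) = α ^ (k + 2) + α ^ k := by
      rw [pow_add, hroot]; ring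
    rw [this]; ring
  have hrec : ∀ k, e (k + 2) + (α - 1) * e (k + 1) + (α ^ 2 - α) * e k = 0 := by
    intro k
    induction k with
    | zero =>
      simp only [he, narayana]
      norm_num
      have h3 : a * (3 * α ^ 2 - 2 * α) = α := by
        have : α * (a * (3 * α ^ 2 - 2 * α)) = α * α := by
          linear_combination ha' + 2 * a * hroot
        exact mul_left_cancel₀ (by positivity) this
      linear_combination -h3
    | succ k ih =>
      have := hrec3 k
      show e (k + 3) + (α - 1) * e (k + 2) + (α ^ 2 - α) * e (k + 1) = 0
      linear_combination α * ih + this - e k * hroot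
  have hlow : ∀ x y : ℝ, x ^ 2 / 2 ≤ y ^ 2 + (α - 1) * y * x + (α ^ 2 - α) * x ^ 2 := by
    intro x y
    have h : 0 ≤ (α ^ 2 - α) - (α - 1) ^ 2 / 4 - 1 / 2 := by nlinarith
    nlinarith [sq_nonneg (y + (α - 1) / 2 * x), mul_nonneg h (sq_nonneg x)]
  have hQ : ∀ k, e (k + 1) ^ 2 + (α - 1) * e (k + 1) * e k + (α ^ 2 - α) * e k ^ 2 ≤ 4 := by
    intro k
    induction k with
    | zero =>
      simp only [he, narayana]
      norm_num
      have hb0 : 0 ≤ a * α := by positivity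
      have hb1 : a * α ≤ 1 := by nlinarith
      have hc : α ^ 2 - α ≤ 1 := by nlinarith
      have hd : (α ^ 2 - α) * a ^ 2 ≤ 1 := by nlinarith [sq_nonneg a]
      have hf : 0 ≤ (α - 1) * (1 - a * α) * a :=
        mul_nonneg (mul_nonneg (by linarith) (by linarith)) ha0
      nlinarith
    | succ k ih =>
      have hr := hrec k
      have hx : e (k + 2) = -(α - 1) * e (k + 1) - (α ^ 2 - α) * e k := by linarith
      have key : e (k + 2) ^ 2 + (α - 1) * e (k + 2) * e (k + 1) + (α ^ 2 - α) * e (k + 1) ^ 2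
          = (α ^ 2 - α) *
            (e (k + 1) ^ 2 + (α - 1) * e (k + 1) * e k + (α ^ 2 - α) * e k ^ 2) := by
        rw [hx]; ring
      show e (k + 2) ^ 2 + (α - 1) * e (k + 2) * e (k + 1) + (α ^ 2 - α) * e (k + 1) ^ 2 ≤ 4
      rw [key]
      have hc : α ^ 2 - α ≤ 1 := by nlinarith
      have hc0 : 0 ≤ α ^ 2 - α := by nlinarith
      nlinarith
  rw [← he]
  apply abs_le_of_sq_le_sq _ (by norm_num)
  have := hQ k
  have := hlow (e k) (e (k + 1))
  linarith

theorem prod_aux (x y z w : ℝ) (hx : 0 ≤ x) (hx1 : x ≤ 1) (hy : 0 ≤ y) (hyx : y ≤ x)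
    (hz : 0 ≤ z) (hzx : z ≤ x) (hw : 0 ≤ w) (hwx : w ≤ x) :
    |(1 - x) * (1 - y) * (1 - z) * (1 - w) - 1| ≤ 4 * x := by
  have h1 : (1 - x) * (1 - y) ≤ 1 := by nlinarith
  have h1' : 0 ≤ (1 - x) * (1 - y) := mul_nonneg (by linarith) (by linarith)
  have h1l : 1 - 2 * x ≤ (1 - x) * (1 - y) := by nlinarith
  have h2' : 0 ≤ (1 - x) * (1 - y) * (1 - z) := mul_nonneg h1' (by linarith)
  have h2 : (1 - x) * (1 - y) * (1 - z) ≤ 1 := by nlinarith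
  have h2l : 1 - 3 * x ≤ (1 - x) * (1 - y) * (1 - z) := by nlinarith
  rw [abs_le]
  constructor <;> nlinarith

theorem lambda_one_bound (α : ℝ) (hα : 1 < α) (hroot : α ^ 3 = α ^ 2 + 1)
    (a : ℝ) (ha : a = α ^ 2 / (α ^ 3 + 2))
    (g k d₁ d₂ d₃ d₄ ℓ m n t : ℕ) (hg : 2 ≤ g) (hk : 1 ≤ k)
    (hd₁ : 1 ≤ d₁) (hd₁g : d₁ ≤ g - 1) (hd₂ : 1 ≤ d₂) (hd₂g : d₂ ≤ g - 1)
    (hd₃ : 1 ≤ d₃) (hd₃g : d₃ ≤ g - 1) (hd₄ : 1 ≤ d₄) (hd₄g : d₄ ≤ g - 1)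
    (hℓ : 1 ≤ ℓ) (hℓm : ℓ ≤ m) (hmn : m ≤ n) (hnt : n ≤ t) (ht : 2 ≤ t)
    (heq : narayana k * (g - 1) ^ 4 =
      d₁ * d₂ * d₃ * d₄ * (g ^ ℓ - 1) * (g ^ m - 1) * (g ^ n - 1) * (g ^ t - 1)) :
    |a * ((g : ℝ) - 1) ^ 4 / ((d₁ : ℝ) * d₂ * d₃ * d₄) * α ^ k *
      (g : ℝ) ^ (-((ℓ : ℤ) + m + n + t)) - 1| < 16 / (g : ℝ) ^ ℓ := by
  have he := narayana_binet_err α hα hroot a ha k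
  have hG : (2 : ℝ) ≤ g := by exact_mod_cast hg
  have hg0 : (0 : ℝ) < g := by linarith
  have hpow : ∀ i : ℕ, ((g ^ i - 1 : ℕ) : ℝ) = (g : ℝ) ^ i - 1 := by
    intro i
    rw [Nat.cast_sub (Nat.one_le_pow _ _ (by omega))]
    push_cast; ring
  have heqR : (narayana k : ℝ) * ((g : ℝ) - 1) ^ 4 =
      (d₁ : ℝ) * d₂ * d₃ * d₄ * ((g : ℝ) ^ ℓ - 1) * ((g : ℝ) ^ m - 1) * ((g : ℝ) ^ n - 1)
        * ((g : ℝ) ^ t - 1) := by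
    have h := congrArg (Nat.cast : ℕ → ℝ) heq
    rw [← hpow, ← hpow, ← hpow, ← hpow]
    have hg1 : ((g - 1 : ℕ) : ℝ) = (g : ℝ) - 1 := by
      rw [Nat.cast_sub (by omega)]; simp
    rw [← hg1]
    exact_mod_cast heq
  have hD : (1 : ℝ) ≤ (d₁ : ℝ) * d₂ * d₃ * d₄ := by
    have : 1 ≤ d₁ * d₂ * d₃ * d₄ :=
      Nat.mul_pos (Nat.mul_pos (Nat.mul_pos hd₁ hd₂) hd₃) hd₄
    exact_mod_cast this
  generalize hDD : (d₁ : ℝ) * d₂ * d₃ * d₄ = D at *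
  have hz : (g : ℝ) ^ (-((ℓ : ℤ) + m + n + t)) = ((g : ℝ) ^ (ℓ + m + n + t))⁻¹ := by
    rw [zpow_neg]
    congr 1
  rw [hz]
  have hmono : ∀ i, ℓ ≤ i → ((g : ℝ) ^ i)⁻¹ ≤ ((g : ℝ) ^ ℓ)⁻¹ := by
    intro i hi
    gcongr
    linarith
  have hx1 : ((g : ℝ) ^ ℓ)⁻¹ ≤ 1 := inv_le_one_of_one_le₀ (one_le_pow₀ (by linarith))
  have hp := prod_aux ((g : ℝ) ^ ℓ)⁻¹ ((g : ℝ) ^ m)⁻¹ ((g : ℝ) ^ n)⁻¹ ((g : ℝ) ^ t)⁻¹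
    (by positivity) hx1 (by positivity) (hmono m hℓm) (by positivity) (hmono n (by omega))
    (by positivity) (hmono t (by omega))
  have hD0 : 0 < D := by linarith
  have hsplit : a * ((g : ℝ) - 1) ^ 4 / D * α ^ k * ((g : ℝ) ^ (ℓ + m + n + t))⁻¹ - 1 =
      ((1 - ((g : ℝ) ^ ℓ)⁻¹) * (1 - ((g : ℝ) ^ m)⁻¹) * (1 - ((g : ℝ) ^ n)⁻¹)
        * (1 - ((g : ℝ) ^ t)⁻¹) - 1)
      - ((narayana k : ℝ) - a * α ^ k) *
        (((g : ℝ) - 1) ^ 4 / D * ((g : ℝ) ^ (ℓ + m + n + t))⁻¹) := by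
    have : (1 - ((g : ℝ) ^ ℓ)⁻¹) * (1 - ((g : ℝ) ^ m)⁻¹) * (1 - ((g : ℝ) ^ n)⁻¹)
        * (1 - ((g : ℝ) ^ t)⁻¹) =
        (narayana k : ℝ) * ((g : ℝ) - 1) ^ 4 / D * ((g : ℝ) ^ (ℓ + m + n + t))⁻¹ := by
      rw [heqR, pow_add, pow_add, pow_add]
      field_simp
    rw [this]; ring
  have hsmall : ((g : ℝ) - 1) ^ 4 / D * ((g : ℝ) ^ (ℓ + m + n + t))⁻¹ ≤ ((g : ℝ) ^ ℓ)⁻¹ := by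
    have s1 : ((g : ℝ) - 1) ^ 4 / D ≤ (g : ℝ) ^ 4 := by
      calc ((g : ℝ) - 1) ^ 4 / D ≤ ((g : ℝ) - 1) ^ 4 :=
            div_le_self (by positivity) hD
        _ ≤ (g : ℝ) ^ 4 := pow_le_pow_left₀ (by linarith) (by linarith) 4
    have s2 : (g : ℝ) ^ (4 + ℓ) ≤ (g : ℝ) ^ (ℓ + m + n + t) :=
      pow_le_pow_right₀ (by linarith) (by omega)
    calc _ ≤ (g : ℝ) ^ 4 * ((g : ℝ) ^ (ℓ + m + n + t))⁻¹ := by gcongr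
      _ ≤ (g : ℝ) ^ 4 * ((g : ℝ) ^ (4 + ℓ))⁻¹ := by gcongr
      _ = ((g : ℝ) ^ ℓ)⁻¹ := by rw [pow_add]; field_simp
  have hs0 : 0 ≤ ((g : ℝ) - 1) ^ 4 / D * ((g : ℝ) ^ (ℓ + m + n + t))⁻¹ := by positivity
  have hxpos : 0 < ((g : ℝ) ^ ℓ)⁻¹ := by positivity
  rw [hsplit, div_eq_mul_inv 16]
  refine lt_of_le_of_lt (abs_sub _ _) ?_
  rw [abs_mul, abs_of_nonneg hs0]
  have := mul_le_mul he hsmall hs0 (by norm_num)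
  linarith
end

section
/- Let g ≥ 2 be an integer, α the unique real root greater than 1 of x³ − x² − 1, and a = α²/(α³ + 2). If integers k ≥ 1, digits 1 ≤ d₁, d₂, d₃, d₄ ≤ g − 1 and exponents 1 ≤ ℓ ≤ m ≤ n ≤ t with t ≥ 2 satisfy N_k = d₁(gˡ−1)/(g−1) · d₂(gᵐ−1)/(g−1) · d₃(gⁿ−1)/(g−1) · d₄(gᵗ−1)/(g−1), then |a·(g−1)⁴/(d₁d₂d₃d₄·(gˡ−1)) · α^k · g^{−(m+n+t)} − 1| < 8/gᵐ. -/
lemma alpha_bounds (α : ℝ) (hα : 1 < α) (hroot : α ^ 3 = α ^ 2 + 1) : 1.4 < α ∧ α < 1.5 := by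
  constructor
  · by_contra h
    push Not at h
    nlinarith [mul_nonneg (sub_nonneg.2 h) (sub_nonneg.2 hα.le), mul_pos (sub_pos.2 hα) (sub_pos.2 hα), mul_nonneg (mul_nonneg (sub_nonneg.2 h) (sub_nonneg.2 hα.le)) (sub_nonneg.2 hα.le)]
  · by_contra h
    push Not at h
    nlinarith [mul_nonneg (sub_nonneg.2 h) (sub_nonneg.2 h), mul_nonneg (sub_nonneg.2 h) (sq_nonneg α)]

lemma err_rec (α a : ℝ) (hroot : α ^ 3 = α ^ 2 + 1) (h1 : a * (3 * α - 2) = 1) (n : ℕ) :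
    ((narayana (n+2) : ℝ) - a * α ^ (n+2)) + (α - 1) * ((narayana (n+1) : ℝ) - a * α ^ (n+1))
      + α * (α - 1) * ((narayana n : ℝ) - a * α ^ n) = 0 := by
  induction n with
  | zero =>
    simp only [narayana]
    push_cast
    linear_combination (-α) * h1
  | succ n ih =>
    have h : narayana (n + 1 + 2) = narayana (n + 2) + narayana n := rfl
    rw [h]
    push_cast
    rw [show n + 1 + 1 = n + 2 from rfl]
    linear_combination α * ih + (- a * α ^ n - ((narayana n : ℝ) - a * α ^ n)) * hroot

lemma err_bound (α : ℝ) (hα : 1 < α) (hroot : α ^ 3 = α ^ 2 + 1)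
    (a : ℝ) (ha : a = α ^ 2 / (α ^ 3 + 2)) (k : ℕ) : |(narayana k : ℝ) - a * α ^ k| < 3 := by
  obtain ⟨hl, hu⟩ := alpha_bounds α hα hroot
  have ha3 : a * (α ^ 3 + 2) = α ^ 2 := by
    rw [ha]; field_simp
  have h1 : a * (3 * α - 2) = 1 := by
    have : α ^ 2 * (a * (3 * α - 2)) = α ^ 2 * 1 := by
      linear_combination ha3 + 2 * a * hroot
    exact mul_left_cancel₀ (by positivity) this
  have ha0 : 0 < a := by rw [ha]; positivity
  have ha1 : a < 1 / 2 := by nlinarith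
  have hQ : ∀ n : ℕ, ((narayana (n+1) : ℝ) - a * α ^ (n+1)) ^ 2
      + (α - 1) * ((narayana (n+1) : ℝ) - a * α ^ (n+1)) * ((narayana n : ℝ) - a * α ^ n)
      + α * (α - 1) * ((narayana n : ℝ) - a * α ^ n) ^ 2 ≤ 3 := by
    intro n
    induction n with
    | zero =>
      simp only [narayana]
      push_cast
      have h2 : a * α < 1 := by nlinarith
      have h3 : 0 < a * α := by positivity
      have h4 : (1 - a * α) * a ≥ 0 := mul_nonneg (by linarith) ha0.le
      have h5 : α * (α - 1) ≤ 1 := by nlinarith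
      have h6 : α * (α - 1) * a ^ 2 ≤ 1 * 1 := by
        apply mul_le_mul h5 (by nlinarith) (by positivity) (by norm_num)
      nlinarith [mul_nonneg (sub_nonneg.2 hα.le) h4]
    | succ n ih =>
      have hr := err_rec α a hroot h1 n
      rw [show n + 1 + 1 = n + 2 from rfl]
      set u := (narayana n : ℝ) - a * α ^ n
      set v := (narayana (n+1) : ℝ) - a * α ^ (n+1)
      set w := (narayana (n+2) : ℝ) - a * α ^ (n+2)
      have hw : w = -(α - 1) * v - α * (α - 1) * u := by linarith
      have e : w ^ 2 + (α - 1) * w * v + α * (α - 1) * v ^ 2 =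
          α * (α - 1) * (v ^ 2 + (α - 1) * v * u + α * (α - 1) * u ^ 2) := by
        rw [hw]; ring
      rw [e]
      have h5 : α * (α - 1) ≤ 1 := by nlinarith
      have h6 : 0 ≤ α * (α - 1) := mul_nonneg (by linarith) (by linarith)
      nlinarith
  have := hQ k
  set u := (narayana k : ℝ) - a * α ^ k
  set v := (narayana (k+1) : ℝ) - a * α ^ (k+1)
  have hc : (0.4:ℝ) ≤ α * (α - 1) - (α - 1) ^ 2 / 4 := by nlinarith
  have hu2 : 0.4 * u ^ 2 ≤ 3 := by
    nlinarith [sq_nonneg (v + (α - 1) / 2 * u), mul_nonneg (sub_nonneg.2 hc) (sq_nonneg u)]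
  apply abs_lt_of_sq_lt_sq _ (by norm_num)
  nlinarith

theorem lambda_two_bound (α : ℝ) (hα : 1 < α) (hroot : α ^ 3 = α ^ 2 + 1)
    (a : ℝ) (ha : a = α ^ 2 / (α ^ 3 + 2))
    (g k d₁ d₂ d₃ d₄ ℓ m n t : ℕ) (hg : 2 ≤ g) (hk : 1 ≤ k)
    (hd₁ : 1 ≤ d₁) (hd₁g : d₁ ≤ g - 1) (hd₂ : 1 ≤ d₂) (hd₂g : d₂ ≤ g - 1)
    (hd₃ : 1 ≤ d₃) (hd₃g : d₃ ≤ g - 1) (hd₄ : 1 ≤ d₄) (hd₄g : d₄ ≤ g - 1)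
    (hℓ : 1 ≤ ℓ) (hℓm : ℓ ≤ m) (hmn : m ≤ n) (hnt : n ≤ t) (ht : 2 ≤ t)
    (heq : narayana k * (g - 1) ^ 4 =
      d₁ * d₂ * d₃ * d₄ * (g ^ ℓ - 1) * (g ^ m - 1) * (g ^ n - 1) * (g ^ t - 1)) :
    |a * ((g : ℝ) - 1) ^ 4 / ((d₁ : ℝ) * d₂ * d₃ * d₄ * ((g : ℝ) ^ ℓ - 1)) * α ^ k *
      (g : ℝ) ^ (-((m : ℤ) + n + t)) - 1| < 8 / (g : ℝ) ^ m := by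
  have he := err_bound α hα hroot a ha k
  have hG : (2:ℝ) ≤ g := by exact_mod_cast hg
  have hpow : ∀ i : ℕ, 1 ≤ g ^ i := fun i => Nat.one_le_pow _ _ (by omega)
  have heqR : (narayana k : ℝ) * ((g:ℝ) - 1) ^ 4 = (d₁ : ℝ) * d₂ * d₃ * d₄ * ((g:ℝ) ^ ℓ - 1)
      * ((g:ℝ) ^ m - 1) * ((g:ℝ) ^ n - 1) * ((g:ℝ) ^ t - 1) := by
    have := congrArg (Nat.cast : ℕ → ℝ) heq
    push_cast [Nat.cast_sub (hpow _), Nat.cast_sub (show 1 ≤ g by omega)] at this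
    exact this
  have hD : (1:ℝ) ≤ (d₁ : ℝ) * d₂ * d₃ * d₄ := by
    have : 1 ≤ d₁ * d₂ * d₃ * d₄ := Nat.mul_pos (Nat.mul_pos (Nat.mul_pos hd₁ hd₂) hd₃) hd₄
    exact_mod_cast this
  have hL : (g:ℝ) - 1 ≤ (g:ℝ) ^ ℓ - 1 := by
    have := le_self_pow₀ (show (1:ℝ) ≤ g by linarith) (show ℓ ≠ 0 by omega)
    linarith
  have hM1 : (1:ℝ) ≤ (g:ℝ) ^ m := one_le_pow₀ (by linarith)
  have hMN : (g:ℝ) ^ m ≤ (g:ℝ) ^ n := pow_le_pow_right₀ (by linarith) hmn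
  have hNT : (g:ℝ) ^ n ≤ (g:ℝ) ^ t := pow_le_pow_right₀ (by linarith) hnt
  have hNT3 : (g:ℝ) ^ 3 ≤ (g:ℝ) ^ n * (g:ℝ) ^ t := by
    rw [← pow_add]
    exact pow_le_pow_right₀ (by linarith) (by omega)
  have hz : (g : ℝ) ^ (-((m : ℤ) + n + t)) = ((g:ℝ) ^ m * (g:ℝ) ^ n * (g:ℝ) ^ t)⁻¹ := by
    rw [zpow_neg, zpow_add₀ (by positivity), zpow_add₀ (by positivity)]
    simp only [zpow_natCast]
  rw [hz]
  set D : ℝ := (d₁ : ℝ) * d₂ * d₃ * d₄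
  set L : ℝ := (g:ℝ) ^ ℓ - 1
  set M : ℝ := (g:ℝ) ^ m
  set N : ℝ := (g:ℝ) ^ n
  set T : ℝ := (g:ℝ) ^ t
  set e : ℝ := (narayana k : ℝ) - a * α ^ k with hedef
  have hg1 : (0:ℝ) < (g:ℝ) - 1 := by linarith
  have hM0 : 0 < M := by linarith
  have hN0 : 0 < N := by linarith
  have hT0 : 0 < T := by linarith
  have hL0 : 0 < L := by linarith
  have hD0 : 0 < D := by linarith
  have key : a * ((g:ℝ) - 1) ^ 4 / (D * L) * α ^ k * (M * N * T)⁻¹ - 1 =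
      ((1 - M⁻¹) * (1 - N⁻¹) * (1 - T⁻¹) - 1) - e * (((g:ℝ) - 1) ^ 4 / (D * L * (M * N * T))) := by
    field_simp
    rw [hedef]
    linear_combination heqR
  have hr : ((g:ℝ) - 1) ^ 4 / (D * L * (M * N * T)) ≤ M⁻¹ := by
    rw [div_le_iff₀ (by positivity)]
    have h1 : ((g:ℝ) - 1) ^ 3 ≤ N * T :=
      (pow_le_pow_left₀ hg1.le (by linarith) 3).trans hNT3
    have h2 : (g:ℝ) - 1 ≤ D * L := by nlinarith
    have h3 : ((g:ℝ) - 1) * ((g:ℝ) - 1) ^ 3 ≤ D * L * (N * T) :=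
      mul_le_mul h2 h1 (by positivity) (by positivity)
    have h4 : M⁻¹ * (D * L * (M * N * T)) = D * L * (N * T) := by field_simp
    rw [h4]
    linarith
  have hr0 : 0 ≤ ((g:ℝ) - 1) ^ 4 / (D * L * (M * N * T)) := by positivity
  have hx0 : 0 < M⁻¹ := by positivity
  have hy0 : 0 < N⁻¹ := by positivity
  have hw0 : 0 < T⁻¹ := by positivity
  have hx1 : M⁻¹ ≤ 1 := inv_le_one_of_one_le₀ hM1
  have hyx : N⁻¹ ≤ M⁻¹ := inv_anti₀ hM0 hMN
  have hwx : T⁻¹ ≤ M⁻¹ := (inv_anti₀ hN0 hNT).trans hyx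
  rw [key, div_eq_mul_inv 8 M]
  set x := M⁻¹
  set y := N⁻¹
  set w := T⁻¹
  set r := ((g:ℝ) - 1) ^ 4 / (D * L * (M * N * T))
  have hb : |e * r| ≤ 3 * x := by
    rw [abs_mul, abs_of_nonneg hr0]
    exact mul_le_mul he.le hr hr0 (by norm_num)
  have p0 : 0 ≤ (1 - x) * (1 - y) := mul_nonneg (by linarith) (by linarith)
  have xy := mul_pos hx0 hy0
  have p1 : (1 - x) * (1 - y) ≤ 1 := by
    have := mul_nonneg hy0.le (sub_nonneg.2 hx1)
    linarith
  have p2 : 1 - x - y ≤ (1 - x) * (1 - y) := by linarith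
  have pw := mul_nonneg p0 hw0.le
  have pw2 : (1 - x) * (1 - y) * w ≤ 1 * w := mul_le_mul_of_nonneg_right p1 hw0.le
  have q1 : (1 - x) * (1 - y) * (1 - w) ≤ 1 := by linarith
  have q2 : 1 - x - y - w ≤ (1 - x) * (1 - y) * (1 - w) := by linarith
  obtain ⟨b1, b2⟩ := abs_le.1 hb
  rw [abs_lt]
  constructor <;> linarith
end

section
/- Let g ≥ 2 be an integer, α the unique real root greater than 1 of x³ − x² − 1, and a = α²/(α³ + 2). If integers k ≥ 1, digits 1 ≤ d₁, d₂, d₃, d₄ ≤ g − 1 and exponents 1 ≤ ℓ ≤ m ≤ n ≤ t with t ≥ 2 satisfy N_k = d₁(gˡ−1)/(g−1) · d₂(gᵐ−1)/(g−1) · d₃(gⁿ−1)/(g−1) · d₄(gᵗ−1)/(g−1), then |a·(g−1)⁴/(d₁d₂d₃d₄·(gˡ−1)(gᵐ−1)(gⁿ−1)) · α^k · g^{−t} − 1| < 2/g^{t−1}. -/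
lemma nar_alpha_bounds (α : ℝ) (hα : 1 < α) (hroot : α ^ 3 = α ^ 2 + 1) :
    1.46 < α ∧ α < 1.47 := by
  constructor
  · by_contra! h
    have h2 : α ^ 2 * (α - 1) = 1 := by linarith
    have h3 : α ^ 2 ≤ 1.46 ^ 2 := by gcongr
    nlinarith [mul_le_mul h3 (by linarith : α - 1 ≤ 0.46) (by linarith) (by norm_num)]
  · by_contra! h
    have h2 : α ^ 2 * (α - 1) = 1 := by linarith
    have h3 : (1.47 : ℝ) ^ 2 ≤ α ^ 2 := by gcongr
    nlinarith [mul_le_mul h3 (by linarith : 0.47 ≤ α - 1) (by norm_num) (by positivity)]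

lemma nar_rec (α : ℝ) (hα : 1 < α) (hroot : α ^ 3 = α ^ 2 + 1)
    (a : ℝ) (ha : a = α ^ 2 / (α ^ 3 + 2)) (k : ℕ) :
    (a * α ^ (k + 2) - narayana (k + 2)) = -(α - 1) * (a * α ^ (k + 1) - narayana (k + 1))
      - (α ^ 2 - α) * (a * α ^ k - narayana k) := by
  induction k with
  | zero =>
    have hp : α ^ 3 + 2 ≠ 0 := by positivity
    have h1 : a * (α ^ 3 + 2) = α ^ 2 := by rw [ha]; field_simp
    simp [narayana]
    have h2 : α * (a * (3 * α ^ 2 - 2 * α) - α) = 0 := by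
      linear_combination h1 + 2 * a * hroot
    have h3 : a * (3 * α ^ 2 - 2 * α) - α = 0 := by
      rcases mul_eq_zero.mp h2 with h | h
      · linarith
      · exact h
    linear_combination h3
  | succ k ih =>
    have hN : (narayana (k + 1 + 2) : ℝ) = narayana (k + 2) + narayana k := by
      rw [show k + 1 + 2 = k + 3 from rfl, narayana]; push_cast; rfl
    rw [hN]
    rw [show k + 1 + 1 = k + 2 from rfl]
    linear_combination α * ih + (narayana k : ℝ) * hroot

lemma nar_err (α : ℝ) (hα : 1 < α) (hroot : α ^ 3 = α ^ 2 + 1)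
    (a : ℝ) (ha : a = α ^ 2 / (α ^ 3 + 2)) (k : ℕ) :
    |a * α ^ k - narayana k| < 1 := by
  obtain ⟨l, u⟩ := nar_alpha_bounds α hα hroot
  have hp : 0 < α ^ 3 + 2 := by positivity
  have l2 : 1.46 ^ 2 < α ^ 2 := by gcongr
  have u2 : α ^ 2 < 1.47 ^ 2 := by gcongr
  have al : 0.41 < a := by rw [ha, lt_div_iff₀ hp]; nlinarith
  have au : a < 0.42 := by rw [ha, div_lt_iff₀ hp]; nlinarith
  have hb0 : 0.66 < α ^ 2 - α := by nlinarith
  have hb1 : α ^ 2 - α < 0.7 := by nlinarith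
  have Q : ∀ k : ℕ, (a * α ^ (k + 1) - narayana (k + 1)) ^ 2
      + (α - 1) * (a * α ^ (k + 1) - narayana (k + 1)) * (a * α ^ k - narayana k)
      + (α ^ 2 - α) * (a * α ^ k - narayana k) ^ 2 ≤ 0.4 := by
    intro k
    induction k with
    | zero =>
      simp [narayana]
      have h1 : 0.59 < a * α := by nlinarith
      have h2 : a * α < 0.62 := by nlinarith
      have h3 : (a * α - 1) ^ 2 < 0.2 := by nlinarith
      have h4 : (α - 1) * (a * α - 1) * a ≤ 0 :=
        mul_nonpos_of_nonpos_of_nonneg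
          (mul_nonpos_of_nonneg_of_nonpos (by linarith) (by linarith)) (by linarith)
      have h5 : a ^ 2 < 0.18 := by nlinarith
      have h6 : (α ^ 2 - α) * a ^ 2 ≤ 0.7 * 0.18 := by gcongr
      norm_num at *
      linarith
    | succ k ih =>
      have hr := nar_rec α hα hroot a ha k
      rw [show k + 1 + 1 = k + 2 from rfl, hr]
      generalize a * α ^ (k + 1) - (narayana (k + 1) : ℝ) = y at *
      generalize a * α ^ k - (narayana k : ℝ) = x at *
      have := mul_le_mul_of_nonneg_left ih (by linarith : 0 ≤ α ^ 2 - α)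
      nlinarith
  have hq := Q k
  generalize a * α ^ (k + 1) - (narayana (k + 1) : ℝ) = y at *
  generalize a * α ^ k - (narayana k : ℝ) = x at *
  rw [← sq_lt_one_iff_abs_lt_one]
  have h1 : (α - 1) ^ 2 ≤ 0.24 := by nlinarith
  nlinarith [sq_nonneg (y + (α - 1) / 2 * x), mul_le_mul_of_nonneg_right h1 (sq_nonneg x),
    mul_le_mul_of_nonneg_right hb0.le (sq_nonneg x)]

theorem lambda_four_bound (α : ℝ) (hα : 1 < α) (hroot : α ^ 3 = α ^ 2 + 1)
    (a : ℝ) (ha : a = α ^ 2 / (α ^ 3 + 2))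
    (g k d₁ d₂ d₃ d₄ ℓ m n t : ℕ) (hg : 2 ≤ g) (hk : 1 ≤ k)
    (hd₁ : 1 ≤ d₁) (hd₁g : d₁ ≤ g - 1) (hd₂ : 1 ≤ d₂) (hd₂g : d₂ ≤ g - 1)
    (hd₃ : 1 ≤ d₃) (hd₃g : d₃ ≤ g - 1) (hd₄ : 1 ≤ d₄) (hd₄g : d₄ ≤ g - 1)
    (hℓ : 1 ≤ ℓ) (hℓm : ℓ ≤ m) (hmn : m ≤ n) (hnt : n ≤ t) (ht : 2 ≤ t)
    (heq : narayana k * (g - 1) ^ 4 =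
      d₁ * d₂ * d₃ * d₄ * (g ^ ℓ - 1) * (g ^ m - 1) * (g ^ n - 1) * (g ^ t - 1)) :
    |a * ((g : ℝ) - 1) ^ 4 /
        ((d₁ : ℝ) * d₂ * d₃ * d₄ * ((g : ℝ) ^ ℓ - 1) * ((g : ℝ) ^ m - 1) * ((g : ℝ) ^ n - 1)) *
      α ^ k * (g : ℝ) ^ (-(t : ℤ)) - 1| < 2 / (g : ℝ) ^ ((t : ℤ) - 1) := by
  have he := nar_err α hα hroot a ha k
  have hg' : (2 : ℝ) ≤ g := by exact_mod_cast hg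
  have hg1 : 1 ≤ g := by omega
  have cs : ∀ j : ℕ, ((g ^ j - 1 : ℕ) : ℝ) = (g : ℝ) ^ j - 1 := by
    intro j
    rw [Nat.cast_sub (Nat.one_le_pow _ _ hg1)]; push_cast; rfl
  have cg : ((g - 1 : ℕ) : ℝ) = (g : ℝ) - 1 := by
    rw [Nat.cast_sub hg1]; push_cast; rfl
  have hE : (narayana k : ℝ) * ((g : ℝ) - 1) ^ 4 =
      ((d₁ : ℝ) * d₂ * d₃ * d₄ * ((g : ℝ) ^ ℓ - 1) * ((g : ℝ) ^ m - 1) * ((g : ℝ) ^ n - 1)) *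
        ((g : ℝ) ^ t - 1) := by
    rw [← cg, ← cs, ← cs, ← cs, ← cs]
    exact_mod_cast heq
  have hp : ∀ j : ℕ, 1 ≤ j → (g : ℝ) - 1 ≤ (g : ℝ) ^ j - 1 := by
    intro j hj
    have : (g : ℝ) ^ 1 ≤ (g : ℝ) ^ j := pow_le_pow_right₀ (by linarith) hj
    linarith [pow_one (g : ℝ)]
  have pl := hp ℓ hℓ
  have pm := hp m (by omega)
  have pn := hp n (by omega)
  have q1 : (1 : ℝ) ≤ d₁ := by exact_mod_cast hd₁
  have q2 : (1 : ℝ) ≤ d₂ := by exact_mod_cast hd₂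
  have q3 : (1 : ℝ) ≤ d₃ := by exact_mod_cast hd₃
  have q4 : (1 : ℝ) ≤ d₄ := by exact_mod_cast hd₄
  have hs : 0 < (g : ℝ) - 1 := by linarith
  have hD : 1 * 1 * 1 * 1 * ((g : ℝ) - 1) * ((g : ℝ) - 1) * ((g : ℝ) - 1) ≤
      ((d₁ : ℝ) * d₂ * d₃ * d₄ * ((g : ℝ) ^ ℓ - 1) * ((g : ℝ) ^ m - 1) * ((g : ℝ) ^ n - 1)) := by
    have r1 := hs.le.trans pl
    have r2 := hs.le.trans pm
    gcongr
  generalize ((d₁ : ℝ) * d₂ * d₃ * d₄ * ((g : ℝ) ^ ℓ - 1) * ((g : ℝ) ^ m - 1) *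
    ((g : ℝ) ^ n - 1)) = D at *
  have hD0 : 0 < D := lt_of_lt_of_le (by positivity) hD
  have hG : 0 < (g : ℝ) ^ t := by positivity
  rw [zpow_sub₀ (by positivity), zpow_neg, zpow_natCast, zpow_one]
  generalize (g : ℝ) ^ t = G at *
  generalize hx : a * α ^ k - (narayana k : ℝ) = e at *
  have key : a * ((g : ℝ) - 1) ^ 4 / D * α ^ k * G⁻¹ - 1 =
      (e * ((g : ℝ) - 1) ^ 4 - D) / (D * G) := by
    field_simp
    linear_combination ((g : ℝ) - 1) ^ 4 * hx + hE
  rw [key, abs_div, abs_of_pos (mul_pos hD0 hG), div_div_eq_mul_div,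
    div_lt_div_iff₀ (mul_pos hD0 hG) hG]
  have hD4 : ((g : ℝ) - 1) ^ 4 ≤ D * ((g : ℝ) - 1) := by
    have := mul_le_mul_of_nonneg_right hD hs.le
    linarith
  obtain ⟨e1, e2⟩ := abs_lt.mp he
  have h4 : 0 < ((g : ℝ) - 1) ^ 4 := by positivity
  have hDg : 0 < D * g := by positivity
  have hb : |e * ((g : ℝ) - 1) ^ 4 - D| < 2 * g * D := by
    rw [abs_lt]
    constructor <;> nlinarith [mul_lt_mul_of_pos_right e1 h4, mul_lt_mul_of_pos_right e2 h4]
  calc _ < 2 * g * D * G := mul_lt_mul_of_pos_right hb hG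
    _ = _ := by ring
end
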